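/- arXiv:1503.03147 — 2 statements merged into one kernel-verified Lean document; each statement's English description precedes it below -/
import Mathlib

section
/- Let (x_λ) be a d-pre-Cauchy net in X, let (y_m) = (x_{φ(m)}) be a subnet of (x_λ), and let x ∈ X. Then for each of the four modes of convergence below, (x_λ) converges to x if and only if (y_m) converges to x: (upper ball) limsup d(c,·) ≤ d(c,x) for all c; (lower ball) limsup d(·,c) ≤ d(x,c) for all c; (upper hole) liminf d(·,c) ≥ d(x,c) for all c; (lower hole) liminf d(c,·) ≥ d(c,x) for all c. -/
open scoped ENNReal

universe u v

/-- liminf of a `[0,∞]`-valued net indexed by a set with relation `r`. -/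
noncomputable def netLiminf {ι : Type v} (r : ι → ι → Prop) (f : ι → ℝ≥0∞) : ℝ≥0∞ :=
  ⨆ γ : ι, ⨅ l : ι, ⨅ _ : r γ l, f l

/-- limsup of a `[0,∞]`-valued net indexed by a set with relation `r`. -/
noncomputable def netLimsup {ι : Type v} (r : ι → ι → Prop) (f : ι → ℝ≥0∞) : ℝ≥0∞ :=
  ⨅ γ : ι, ⨆ l : ι, ⨆ _ : r γ l, f l

/-- `lim f = L` : both liminf and limsup equal `L`. -/
def NetLimEq {ι : Type v} (r : ι → ι → Prop) (f : ι → ℝ≥0∞) (L : ℝ≥0∞) : Prop :=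
  netLiminf r f = L ∧ netLimsup r f = L

/-- `d` satisfies the triangle inequality. -/
def IsDistance {X : Type u} (d : X → X → ℝ≥0∞) : Prop :=
  ∀ x y z, d x z ≤ d x y + d y z

/-- the index relation is transitive and directed. -/
def DirectedIndex {ι : Type v} (r : ι → ι → Prop) : Prop :=
  (∀ a b c : ι, r a b → r b c → r a c) ∧ (∀ a b : ι, ∃ c, r a c ∧ r b c)

/-- `d`-Cauchy net. -/
def IsCauchyNet {X : Type u} {ι : Type v} (d : X → X → ℝ≥0∞) (r : ι → ι → Prop)
    (x : ι → X) : Prop :=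
  ∀ ε : ℝ≥0∞, 0 < ε → ∃ α, ∀ γ δ, r α γ → r γ δ → d (x γ) (x δ) < ε

/-- `d`-pre-Cauchy net. -/
def IsPreCauchyNet {X : Type u} {ι : Type v} (d : X → X → ℝ≥0∞) (r : ι → ι → Prop)
    (x : ι → X) : Prop :=
  ∀ ε : ℝ≥0∞, 0 < ε → ∃ α, ∀ γ, r α γ → ∃ β, ∀ δ, r β δ → d (x γ) (x δ) < ε

/-- `d`-reflexive net. -/
def IsReflexiveNet {X : Type u} {ι : Type v} (d : X → X → ℝ≥0∞) (r : ι → ι → Prop)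
    (x : ι → X) : Prop :=
  ∀ ε : ℝ≥0∞, 0 < ε → ∃ α, ∀ γ, r α γ → ∀ β, ∃ δ, r β δ ∧ d (x γ) (x δ) < ε

/-- `x` is a `d`-supremum of `Y`. -/
def IsDSup {X : Type u} (d : X → X → ℝ≥0∞) (Y : Set X) (x : X) : Prop :=
  (∀ y ∈ Y, d y x = 0) ∧ ∀ z, d x z = ⨆ y ∈ Y, d y z

/-- `x` is a `≤ᵈ`-supremum of `Y`. -/
def IsLeDSup {X : Type u} (d : X → X → ℝ≥0∞) (Y : Set X) (x : X) : Prop :=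
  (∀ y ∈ Y, d y x = 0) ∧ ∀ z, (∀ y ∈ Y, d y z = 0) → d x z = 0

/-- `Y` is `d`-directed. -/
def DDirected {X : Type u} (d : X → X → ℝ≥0∞) (Y : Set X) : Prop :=
  ∀ F : Finset X, ↑F ⊆ Y → ∀ ε : ℝ≥0∞, 0 < ε → ∃ y ∈ Y, ∀ z ∈ F, d z y < ε

/-- `Y` is `≤ᵈ`-directed (directed sets are nonempty). -/
def LeDDirected {X : Type u} (d : X → X → ℝ≥0∞) (Y : Set X) : Prop :=
  Y.Nonempty ∧ ∀ y₁ ∈ Y, ∀ y₂ ∈ Y, ∃ y ∈ Y, d y₁ y = 0 ∧ d y₂ y = 0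

/-- `X` is `f`-complete: every `f`-Cauchy net has an `X°°`-limit w.r.t. `f`. -/
def IsYonedaComplete {X : Type u} (f : X → X → ℝ≥0∞) : Prop :=
  ∀ (ι : Type u) (r : ι → ι → Prop) (x : ι → X), Nonempty ι → DirectedIndex r →
    IsCauchyNet f r x →
    ∃ z : X, (∀ c, f z c ≤ netLiminf r fun l => f (x l) c) ∧
             (∀ c, f c z ≤ netLiminf r fun l => f c (x l))

/-- `d^•(s) = sup_x inf { d(x,y) : y ≤ᵈ x^•_s }`. -/
noncomputable def dBulletUpper {X : Type u} (d : X → X → ℝ≥0∞) (s : ℝ≥0∞) : ℝ≥0∞ :=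
  ⨆ x : X, ⨅ y : X, ⨅ _ : ∀ z, d x z < s → d y z = 0, d x y

/-- `d_•(s) = sup_x inf { d(y,x) : x^s_• ≤ᵈ y }`. -/
noncomputable def dBulletLower {X : Type u} (d : X → X → ℝ≥0∞) (s : ℝ≥0∞) : ℝ≥0∞ :=
  ⨆ x : X, ⨅ y : X, ⨅ _ : ∀ z, d z x < s → d z y = 0, d y x

/-- `d_F(s)`. -/
noncomputable def dFin {X : Type u} (d : X → X → ℝ≥0∞) (s : ℝ≥0∞) : ℝ≥0∞ :=
  ⨆ x : X, ⨆ F : Finset X, ⨆ _ : ∀ z ∈ F, d z x < s,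
    ⨅ y : X, ⨅ _ : ∀ z ∈ F, d z y = 0, d y x

/-- `d_Φ(s)`. -/
noncomputable def dPhi {X : Type u} (d : X → X → ℝ≥0∞) (s : ℝ≥0∞) : ℝ≥0∞ :=
  ⨆ x : X, ⨆ F : Finset X, ⨆ _ : ∀ z ∈ F, d z x < s, ⨆ ε : ℝ≥0∞, ⨆ _ : 0 < ε,
    ⨅ y : X, ⨅ _ : ∀ z ∈ F, d z y < ε, d y x

/-- `e∘Φᵈ(x,y) = sup_{ε>0} inf { e(x,z) : d(z,y) < ε }`. -/
noncomputable def ePhiD {X : Type u} (e d : X → X → ℝ≥0∞) (x y : X) : ℝ≥0∞ :=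
  ⨆ ε : ℝ≥0∞, ⨆ _ : 0 < ε, ⨅ z : X, ⨅ _ : d z y < ε, e x z

/-- `f ⪅ g` : uniform subequivalence. -/
def SubEquiv {X : Type u} (f g : X → X → ℝ≥0∞) : Prop :=
  ∀ ε : ℝ≥0∞, 0 < ε → ∃ δ : ℝ≥0∞, 0 < δ ∧ ∀ x y, g x y ≤ δ → f x y ≤ ε

theorem netLiminf_le_netLimsup {κ : Type*} {s : κ → κ → Prop} (hs : DirectedIndex s)
    (f : κ → ℝ≥0∞) : netLiminf s f ≤ netLimsup s f := by
  refine iSup_le fun a => le_iInf fun b => ?_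
  obtain ⟨c, hac, hbc⟩ := hs.2 a b
  exact (iInf₂_le c hac).trans (le_iSup₂ (f := fun l (_ : s b l) => f l) c hbc)

theorem netLiminf_le_subnet {ι κ : Type*} {r : ι → ι → Prop} {s : κ → κ → Prop} {φ : κ → ι}
    (hsub : ∀ α, ∃ β, ∀ m, s β m → r α (φ m)) (f : ι → ℝ≥0∞) :
    netLiminf r f ≤ netLiminf s fun m => f (φ m) := by
  refine iSup_le fun α => ?_
  obtain ⟨β, hβ⟩ := hsub α
  exact le_iSup_of_le β (le_iInf₂ fun m hm => iInf₂_le (φ m) (hβ m hm))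

theorem netLimsup_subnet_le {ι κ : Type*} {r : ι → ι → Prop} {s : κ → κ → Prop} {φ : κ → ι}
    (hsub : ∀ α, ∃ β, ∀ m, s β m → r α (φ m)) (f : ι → ℝ≥0∞) :
    (netLimsup s fun m => f (φ m)) ≤ netLimsup r f := by
  refine le_iInf fun α => ?_
  obtain ⟨β, hβ⟩ := hsub α
  exact iInf_le_of_le β (iSup₂_le fun m hm =>
    le_iSup₂ (f := fun l (_ : r α l) => f l) (φ m) (hβ m hm))

/-- A net whose limsup is at most its liminf has the same limsup and liminf along subnets. -/
theorem subnet_limits_eq {ι κ : Type*} {r : ι → ι → Prop} {s : κ → κ → Prop}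
    (hs : DirectedIndex s) {φ : κ → ι} (hsub : ∀ α, ∃ β, ∀ m, s β m → r α (φ m))
    {f : ι → ℝ≥0∞} (hf : netLimsup r f ≤ netLiminf r f) :
    (netLimsup s fun m => f (φ m)) = netLimsup r f ∧
      (netLiminf s fun m => f (φ m)) = netLiminf r f := by
  have hinf := netLiminf_le_subnet hsub f
  have hsup := netLimsup_subnet_le hsub f
  have hle := netLiminf_le_netLimsup hs fun m => f (φ m)
  exact ⟨hsup.antisymm (hf.trans (hinf.trans hle)), (hle.trans (hsup.trans hf)).antisymm hinf⟩

theorem IsPreCauchyNet.netLimsup_left_le {X : Type*} {ι : Type*} {d : X → X → ℝ≥0∞}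
    (hd : IsDistance d) {r : ι → ι → Prop} {x : ι → X} (hx : IsPreCauchyNet d r x) (c : X) :
    (netLimsup r fun l => d (x l) c) ≤ netLiminf r fun l => d (x l) c := by
  refine ENNReal.le_of_forall_pos_le_add fun ε hε _ => ?_
  obtain ⟨α, hα⟩ := hx ε (by exact_mod_cast hε)
  refine iInf_le_of_le α (iSup₂_le fun γ hγ => ?_)
  obtain ⟨β, hβ⟩ := hα γ hγ
  rw [← tsub_le_iff_right]
  refine le_iSup_of_le β (le_iInf₂ fun δ hδ => ?_)
  rw [tsub_le_iff_left]
  exact (hd _ (x δ) _).trans (add_le_add_left (hβ δ hδ).le _)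

theorem IsPreCauchyNet.netLimsup_right_le {X : Type*} {ι : Type*} {d : X → X → ℝ≥0∞}
    (hd : IsDistance d) {r : ι → ι → Prop} {x : ι → X} (hx : IsPreCauchyNet d r x) (c : X) :
    (netLimsup r fun l => d c (x l)) ≤ netLiminf r fun l => d c (x l) := by
  refine ENNReal.le_of_forall_pos_le_add fun ε hε _ => ?_
  obtain ⟨α, hα⟩ := hx ε (by exact_mod_cast hε)
  rw [← tsub_le_iff_right]
  refine le_iSup_of_le α (le_iInf₂ fun γ hγ => ?_)
  rw [tsub_le_iff_right]
  obtain ⟨β, hβ⟩ := hα γ hγ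
  exact iInf_le_of_le β (iSup₂_le fun δ hδ =>
    (hd _ (x γ) _).trans (add_le_add_right (hβ δ hδ).le _))

/-- A d-pre-Cauchy net converges (in each of the four ball/hole modes) iff a given
subnet converges to the same point in the same mode. -/
theorem preCauchy_subnet_convergence {X : Type u} {ι : Type v} {M : Type*}
    (d : X → X → ℝ≥0∞) (hd : IsDistance d)
    (r : ι → ι → Prop) (hne : Nonempty ι) (hr : DirectedIndex r)
    (x : ι → X) (hx : IsPreCauchyNet d r x)
    (s : M → M → Prop) (hneM : Nonempty M) (hs : DirectedIndex s)
    (φ : M → ι) (hsub : ∀ α : ι, ∃ β : M, ∀ m : M, s β m → r α (φ m))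
    (x₀ : X) :
    ((∀ c : X, netLimsup r (fun l => d c (x l)) ≤ d c x₀) ↔
     (∀ c : X, netLimsup s (fun m => d c (x (φ m))) ≤ d c x₀)) ∧
    ((∀ c : X, netLimsup r (fun l => d (x l) c) ≤ d x₀ c) ↔
     (∀ c : X, netLimsup s (fun m => d (x (φ m)) c) ≤ d x₀ c)) ∧
    ((∀ c : X, d x₀ c ≤ netLiminf r fun l => d (x l) c) ↔
     (∀ c : X, d x₀ c ≤ netLiminf s fun m => d (x (φ m)) c)) ∧
    ((∀ c : X, d c x₀ ≤ netLiminf r fun l => d c (x l)) ↔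
     (∀ c : X, d c x₀ ≤ netLiminf s fun m => d c (x (φ m)))) := by
  have left c := subnet_limits_eq hs hsub (hx.netLimsup_left_le hd c)
  have right c := subnet_limits_eq hs hsub (hx.netLimsup_right_le hd c)
  exact ⟨forall_congr' fun c => by rw [(right c).1], forall_congr' fun c => by rw [(left c).1],
    forall_congr' fun c => by rw [(left c).2], forall_congr' fun c => by rw [(right c).2]⟩
end

section
/- Let e be a symmetric distance on X (e(x,y) = e(y,x) for all x,y). Suppose X is e-complete, e-separable, e∘Φ^d ⪅ d, and d ⪅ e. Then for every d-Cauchy net (x_λ) in X there is a ≤^d-directed set Y ⊆ X such that sup_{y∈Y} d(y,z) = lim_λ d(x_λ,z) and inf_{y∈Y} d(z,y) = lim_λ d(z,x_λ) for all z ∈ X. -/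
open scoped ENNReal

universe u v

open Filter

section NetLimits

variable {ι : Type v} {r : ι → ι → Prop} {f : ι → ℝ≥0∞} {b : ℝ≥0∞}

lemma le_netLiminf_of_forall_pos
    (h : ∀ ε : ℝ≥0∞, 0 < ε → ∃ α, ∀ l, r α l → b ≤ f l + ε) : b ≤ netLiminf r f := by
  refine ENNReal.le_of_forall_pos_le_add fun ε hε _ => ?_
  obtain ⟨α, hα⟩ := h ε (by exact_mod_cast hε)
  rw [← tsub_le_iff_right]
  exact le_iSup_of_le α (le_iInf₂ fun l hl => tsub_le_iff_right.2 (hα l hl))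

lemma netLimsup_le_of_forall_pos
    (h : ∀ ε : ℝ≥0∞, 0 < ε → ∃ α, ∀ l, r α l → f l ≤ b + ε) : netLimsup r f ≤ b := by
  refine ENNReal.le_of_forall_pos_le_add fun ε hε _ => ?_
  obtain ⟨α, hα⟩ := h ε (by exact_mod_cast hε)
  exact iInf_le_of_le α (iSup₂_le hα)

lemma netLiminf_le_netLimsup_s14 (hr : DirectedIndex r) : netLiminf r f ≤ netLimsup r f := by
  refine iSup_le fun a => le_iInf fun c => ?_
  obtain ⟨l, hal, hcl⟩ := hr.2 a c
  exact (iInf₂_le l hal).trans (le_iSup₂_of_le l hcl le_rfl)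

lemma netLimEq_of_le (hr : DirectedIndex r) (hsup : netLimsup r f ≤ b)
    (hinf : b ≤ netLiminf r f) : NetLimEq r f b :=
  ⟨((netLiminf_le_netLimsup_s14 hr).trans hsup).antisymm hinf,
    hsup.antisymm (hinf.trans (netLiminf_le_netLimsup_s14 hr))⟩

/-- A set that is mutually cofinal with a net, up to arbitrarily small `d`-error, has the same
upper and lower distance functions as the net. -/
lemma netLimEq_of_mutually_cofinal {X : Type u} {d : X → X → ℝ≥0∞} (hd : IsDistance d)
    (hr : DirectedIndex r) {x : ι → X} {Y : Set X}
    (hY : ∀ y ∈ Y, ∀ ε : ℝ≥0∞, 0 < ε → ∃ α, ∀ l, r α l → d y (x l) ≤ ε)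
    (hx : ∀ ε : ℝ≥0∞, 0 < ε → ∃ α, ∀ l, r α l → ∃ y ∈ Y, d (x l) y ≤ ε) :
    (∀ z : X, NetLimEq r (fun l => d (x l) z) (⨆ y ∈ Y, d y z)) ∧
      (∀ z : X, NetLimEq r (fun l => d z (x l)) (⨅ y ∈ Y, d z y)) := by
  refine ⟨fun z => netLimEq_of_le hr (netLimsup_le_of_forall_pos fun ε hε => ?_)
      (iSup₂_le fun y hy => le_netLiminf_of_forall_pos fun ε hε => ?_),
    fun z => netLimEq_of_le hr
      (le_iInf₂ fun y hy => netLimsup_le_of_forall_pos fun ε hε => ?_)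
      (le_netLiminf_of_forall_pos fun ε hε => ?_)⟩
  · obtain ⟨α, hα⟩ := hx ε hε
    refine ⟨α, fun l hl => ?_⟩
    obtain ⟨y, hy, hly⟩ := hα l hl
    calc d (x l) z ≤ d (x l) y + d y z := hd _ _ _
      _ ≤ ε + ⨆ y ∈ Y, d y z := add_le_add hly (le_iSup₂_of_le y hy le_rfl)
      _ = _ := add_comm _ _
  · obtain ⟨α, hα⟩ := hY y hy ε hε
    refine ⟨α, fun l hl => (hd y (x l) z).trans ?_⟩
    rw [add_comm]
    gcongr
    exact hα l hl
  · obtain ⟨α, hα⟩ := hY y hy ε hε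
    refine ⟨α, fun l hl => (hd z y (x l)).trans ?_⟩
    gcongr
    exact hα l hl
  · obtain ⟨α, hα⟩ := hx ε hε
    refine ⟨α, fun l hl => ?_⟩
    obtain ⟨y, hy, hly⟩ := hα l hl
    calc ⨅ y ∈ Y, d z y ≤ d z y := iInf₂_le y hy
      _ ≤ d z (x l) + d (x l) y := hd _ _ _
      _ ≤ _ := by gcongr

end NetLimits

lemma ENNReal.eventually_two_mul_inv_two_pow_le {ε : ℝ≥0∞} (hε : 0 < ε) :
    ∀ᶠ n : ℕ in atTop, 2 * (2⁻¹ : ℝ≥0∞) ^ n ≤ ε := by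
  have h : Tendsto (fun n : ℕ => 2 * (2⁻¹ : ℝ≥0∞) ^ n) atTop (nhds (2 * 0)) :=
    ENNReal.Tendsto.const_mul
      (ENNReal.tendsto_pow_atTop_nhds_zero_of_lt_one (by simp))
      (Or.inr (by simp))
  rw [mul_zero] at h
  exact h.eventually_le_const hε

lemma ENNReal.eventually_inv_two_pow_le {ε : ℝ≥0∞} (hε : 0 < ε) :
    ∀ᶠ n : ℕ in atTop, (2⁻¹ : ℝ≥0∞) ^ n ≤ ε := by
  filter_upwards [ENNReal.eventually_two_mul_inv_two_pow_le hε] with n hn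
  exact (le_mul_of_one_le_left' one_le_two).trans hn

lemma ENNReal.inv_two_pow_pos (n : ℕ) : 0 < (2⁻¹ : ℝ≥0∞) ^ n :=
  ENNReal.pow_pos (by simp) n

lemma ENNReal.two_mul_inv_two_pow_succ (n : ℕ) :
    2 * (2⁻¹ : ℝ≥0∞) ^ (n + 1) = 2⁻¹ ^ n := by
  rw [pow_succ', ← mul_assoc, ENNReal.mul_inv_cancel (by simp) (by simp), one_mul]

section Distances

variable {X : Type u} {d e : X → X → ℝ≥0∞}

/-- A sequence with geometrically decreasing steps stays geometrically close to some point. -/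
lemma exists_limit_of_geometric_steps (he : IsDistance e) (hrefl : ∀ x, e x x = 0)
    (hcomp : IsYonedaComplete e) (a : ℕ) (s : ℕ → X)
    (hs : ∀ n, e (s n) (s (n + 1)) ≤ 2⁻¹ ^ (n + a)) :
    ∃ z, ∀ n, e (s n) z ≤ 2 * 2⁻¹ ^ (n + a) := by
  have key : ∀ n j, e (s n) (s (n + j)) + 2 * 2⁻¹ ^ (n + j + a) ≤ 2 * 2⁻¹ ^ (n + a) := by
    intro n j
    induction j with
    | zero => simp [hrefl]
    | succ j ih =>
      refine le_trans ?_ ih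
      have h1 := (he (s n) (s (n + j)) (s (n + j + 1))).trans
        (add_le_add_right (hs (n + j)) _)
      have h2 : n + (j + 1) + a = (n + j + a) + 1 := by ring
      rw [h2, ENNReal.two_mul_inv_two_pow_succ, two_mul, ← add_assoc, ← add_assoc]
      gcongr
  have key' : ∀ n m, n ≤ m → e (s n) (s m) ≤ 2 * 2⁻¹ ^ (n + a) := by
    intro n m hnm
    obtain ⟨j, rfl⟩ := Nat.exists_eq_add_of_le hnm
    exact le_self_add.trans (key n j)
  obtain ⟨z, -, hz⟩ := hcomp (ULift ℕ) (fun i j => i.down ≤ j.down) (fun i => s i.down) ⟨⟨0⟩⟩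
    ⟨fun _ _ _ => le_trans, fun i j => ⟨⟨max i.down j.down⟩, le_max_left _ _, le_max_right _ _⟩⟩ (by
      intro ε hε
      obtain ⟨ε', hε', hlt⟩ := exists_between hε
      obtain ⟨N, hN⟩ := eventually_atTop.1 (ENNReal.eventually_two_mul_inv_two_pow_le hε')
      refine ⟨⟨N⟩, fun i j hi hij => ?_⟩
      exact ((key' _ _ hij).trans (hN _ (le_add_right hi))).trans_lt hlt)
  refine ⟨z, fun n => (hz (s n)).trans (iSup_le fun i => ?_)⟩
  exact iInf₂_le_of_le ⟨max i.down n⟩ (le_max_left _ _) (key' _ _ (le_max_right _ _))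

lemma exists_close_of_subEquiv_ePhiD (h1 : SubEquiv (ePhiD e d) d) {ε : ℝ≥0∞} (hε : 0 < ε) :
    ∃ δ : ℝ≥0∞, 0 < δ ∧ ∀ x y, d x y ≤ δ →
      ∀ ε' : ℝ≥0∞, 0 < ε' → ∃ z, d z y < ε' ∧ e x z ≤ ε := by
  obtain ⟨c, hc, hcε⟩ := exists_between hε
  obtain ⟨δ, hδ, h⟩ := h1 c hc
  refine ⟨δ, hδ, fun x y hxy ε' hε' => ?_⟩
  have h3 : (⨅ z : X, ⨅ _ : d z y < ε', e x z) < ε :=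
    (le_iSup₂_of_le (f := fun (ε' : ℝ≥0∞) (_ : 0 < ε') => ⨅ z : X, ⨅ _ : d z y < ε', e x z)
      ε' hε' le_rfl).trans_lt ((h x y hxy).trans_lt hcε)
  simp only [iInf_lt_iff] at h3
  obtain ⟨z, hz, hxz⟩ := h3
  exact ⟨z, hz, hxz.le⟩

/-- If `d x y` is small then some `z` which is `e`-close to `x` satisfies `d z y = 0` exactly. -/
lemma exists_close_eq_zero (hd : IsDistance d) (he : IsDistance e)
    (hsym : ∀ x y : X, e x y = e y x) (hrefl : ∀ x, e x x = 0)
    (hcomp : IsYonedaComplete e) (h1 : SubEquiv (ePhiD e d) d) (h2 : SubEquiv d e)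
    {ε : ℝ≥0∞} (hε : 0 < ε) :
    ∃ δ : ℝ≥0∞, 0 < δ ∧ ∀ x y, d x y ≤ δ → ∃ z, d z y = 0 ∧ e x z ≤ ε := by
  obtain ⟨a, ha⟩ := (ENNReal.eventually_two_mul_inv_two_pow_le hε).exists
  choose δ hδ0 hδ using fun n : ℕ =>
    exists_close_of_subEquiv_ePhiD h1 (ENNReal.inv_two_pow_pos (n + a))
  have hδ0' : ∀ n, 0 < min (δ n) (2⁻¹ ^ n) :=
    fun n => lt_min (hδ0 n) (ENNReal.inv_two_pow_pos n)
  refine ⟨_, hδ0' 0, fun x y hxy => ?_⟩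
  have hstep : ∀ (n : ℕ) (s : X), ∃ z, d s y ≤ min (δ n) (2⁻¹ ^ n) →
      d z y ≤ min (δ (n + 1)) (2⁻¹ ^ (n + 1)) ∧ e s z ≤ 2⁻¹ ^ (n + a) := by
    intro n s
    by_cases h : d s y ≤ min (δ n) (2⁻¹ ^ n)
    · obtain ⟨z, hz, hsz⟩ := hδ n s y (h.trans (min_le_left _ _)) _ (hδ0' (n + 1))
      exact ⟨z, fun _ => ⟨hz.le, hsz⟩⟩
    · exact ⟨s, fun h' => absurd h' h⟩
  choose F hF using hstep
  let s : ℕ → X := fun n => Nat.rec x F n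
  have hs : ∀ n, d (s n) y ≤ min (δ n) (2⁻¹ ^ n) := by
    intro n
    induction n with
    | zero => exact hxy
    | succ n ih => exact (hF n (s n) ih).1
  obtain ⟨z, hz⟩ := exists_limit_of_geometric_steps he hrefl hcomp a s
    fun n => (hF n (s n) (hs n)).2
  refine ⟨z, ?_, (hz 0).trans (by simpa using ha)⟩
  refine nonpos_iff_eq_zero.1 (le_of_forall_pos_le_add fun c hc => ?_)
  rw [zero_add]
  have hc2 : 0 < c / 2 := ENNReal.half_pos hc.ne'
  obtain ⟨w, hw, hw'⟩ := h2 _ hc2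
  obtain ⟨n, hn, hn'⟩ := (((tendsto_add_atTop_nat a).eventually
    (ENNReal.eventually_two_mul_inv_two_pow_le hw)).and
      (ENNReal.eventually_inv_two_pow_le hc2)).exists
  calc d z y ≤ d z (s n) + d (s n) y := hd _ _ _
    _ ≤ c / 2 + c / 2 := add_le_add
      (hw' _ _ ((hsym _ _).trans_le ((hz n).trans hn)))
      ((hs n).trans ((min_le_right _ _).trans hn'))
    _ = c := ENNReal.add_halves c

/-- There are thresholds such that every sequence whose consecutive `d`-distances stay below them
is `e`-asymptotic to a `≤ᵈ`-increasing sequence. -/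
lemma exists_increasing_asymptotic (hd : IsDistance d) (he : IsDistance e)
    (hsym : ∀ x y : X, e x y = e y x) (hrefl : ∀ x, e x x = 0)
    (hcomp : IsYonedaComplete e) (h1 : SubEquiv (ePhiD e d) d) (h2 : SubEquiv d e) :
    ∃ δ : ℕ → ℝ≥0∞, (∀ n, 0 < δ n) ∧ ∀ x : ℕ → X, (∀ n, d (x n) (x (n + 1)) ≤ δ n) →
      ∃ y : ℕ → X, (∀ n, d (y n) (y (n + 1)) = 0) ∧ ∀ n, e (x n) (y n) ≤ 2 * 2⁻¹ ^ n := by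
  choose! D hD0 hD using fun (ε : ℝ≥0∞) (hε : 0 < ε) =>
    exists_close_eq_zero hd he hsym hrefl hcomp h1 h2 hε
  choose! W hW0 hW using h2
  let t : ℕ → ℝ≥0∞ := fun m => Nat.rec 1 (fun m c => min (2⁻¹ ^ (m + 1)) (W (D c))) m
  have ht_succ : ∀ m, t (m + 1) = min (2⁻¹ ^ (m + 1)) (W (D (t m))) := fun _ => rfl
  have ht0 : ∀ m, 0 < t m := by
    intro m
    induction m with
    | zero => exact one_pos
    | succ m ih => exact lt_min (ENNReal.inv_two_pow_pos _) (hW0 _ (hD0 _ ih))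
  have ht : ∀ m, t m ≤ 2⁻¹ ^ m := by
    rintro (_ | m)
    · simp [t]
    · exact min_le_left _ _
  refine ⟨fun n => D (t (2 * n)), fun n => hD0 _ (ht0 _), fun x hx => ?_⟩
  have hstep : ∀ (m : ℕ) (a b : X), ∃ z, d a b ≤ D (t m) → d z b = 0 ∧ e a z ≤ t m := by
    intro m a b
    by_cases h : d a b ≤ D (t m)
    · exact (hD _ (ht0 m) a b h).imp fun z hz _ => hz
    · exact ⟨a, fun h' => absurd h' h⟩
  choose F hF using hstep
  let z : ℕ → ℕ → X := fun k =>
    Nat.rec x (fun k w n => F (2 * n + k) (w n) (w (n + 1))) k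
  have hz : ∀ k n, d (z k n) (z k (n + 1)) ≤ D (t (2 * n + k)) := by
    intro k
    induction k with
    | zero => exact hx
    | succ k ih =>
      intro n
      calc d (z (k + 1) n) (z (k + 1) (n + 1))
          ≤ d (z (k + 1) n) (z k (n + 1)) + d (z k (n + 1)) (z (k + 1) (n + 1)) := hd _ _ _
        _ = d (z k (n + 1)) (z (k + 1) (n + 1)) := by
          rw [(hF _ _ _ (ih n)).1, zero_add]
        _ ≤ D (t (2 * n + (k + 1))) := by
          refine hW _ (hD0 _ (ht0 (2 * n + (k + 1)))) _ _ ((hF _ _ _ (ih (n + 1))).2.trans ?_)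
          rw [show 2 * (n + 1) + k = (2 * n + (k + 1)) + 1 by ring, ht_succ]
          exact min_le_right _ _
  choose y hy using fun n => exists_limit_of_geometric_steps he hrefl hcomp (2 * n)
    (fun k => z k n) fun k => by
      rw [add_comm k (2 * n)]
      exact (hF _ _ _ (hz k n)).2.trans (ht _)
  refine ⟨y, fun n => ?_, fun n => (hy n 0).trans ?_⟩
  · refine nonpos_iff_eq_zero.1 (le_of_forall_pos_le_add fun c hc => ?_)
    rw [zero_add]
    have hc2 : 0 < c / 2 := ENNReal.half_pos hc.ne'
    have hev := ENNReal.eventually_two_mul_inv_two_pow_le (hW0 _ hc2)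
    obtain ⟨k, hk, hk'⟩ := (((tendsto_add_atTop_nat (1 + 2 * n)).eventually hev).and
      ((tendsto_add_atTop_nat (2 * (n + 1))).eventually hev)).exists
    calc d (y n) (y (n + 1))
        ≤ d (y n) (z (k + 1) n) + (d (z (k + 1) n) (z k (n + 1)) + d (z k (n + 1)) (y (n + 1))) :=
          (hd _ _ _).trans (add_le_add_right (hd _ _ _) _)
      _ = d (y n) (z (k + 1) n) + d (z k (n + 1)) (y (n + 1)) := by
          rw [(hF _ _ _ (hz k n)).1, zero_add]
      _ ≤ c / 2 + c / 2 := by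
          refine add_le_add (hW _ hc2 _ _ ?_) (hW _ hc2 _ _ ((hy (n + 1) k).trans hk'))
          rw [hsym]
          exact (hy n (k + 1)).trans (by rwa [add_assoc])
      _ = c := ENNReal.add_halves c
  · gcongr 2 * ?_
    exact pow_le_pow_right_of_le_one' (by simp) (by omega)

/-- In an `e`-separable space a `d`-Cauchy net contains a sequence, as quickly `d`-Cauchy as
desired, that is cofinal with the net up to arbitrarily small `d`-error. -/
lemma exists_cofinal_seq_of_isCauchyNet {ι : Type v} (hd : IsDistance d)
    (hsym : ∀ x y : X, e x y = e y x)
    (hsep : ∃ Y₀ : Set X, Y₀.Countable ∧ ∀ x : X, (⨅ y ∈ Y₀, e x y) = 0)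
    (h2 : SubEquiv d e) {r : ι → ι → Prop} (hne : Nonempty ι) (hr : DirectedIndex r)
    {x : ι → X} (hx : IsCauchyNet d r x) (δ : ℕ → ℝ≥0∞) (hδ : ∀ n, 0 < δ n) :
    ∃ p : ℕ → ι, (∀ n, r (p n) (p (n + 1))) ∧ (∀ n l, r (p n) l → d (x (p n)) (x l) < δ n) ∧
      ∀ ε : ℝ≥0∞, 0 < ε → ∃ α, ∀ l, r α l → ∀ᶠ n in atTop, d (x l) (x (p n)) ≤ ε := by
  choose! A hA using hx
  choose! W hW0 hW using h2
  obtain ⟨Y₀, hcount, hdense⟩ := hsep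
  have hY₀ : Y₀.Nonempty := by
    by_contra h
    rw [Set.not_nonempty_iff_eq_empty] at h
    subst h
    simpa using hdense (x hne.some)
  obtain ⟨u, rfl⟩ := hcount.exists_eq_range hY₀
  let η : ℕ → ℝ≥0∞ := fun k => 2⁻¹ ^ k
  have hη : ∀ k, 0 < η k := ENNReal.inv_two_pow_pos
  have hg : ∀ i k : ℕ, ∃ c, ∀ l, r (A (η k)) l → e (x l) (u i) ≤ W (η k) →
      r (A (η k)) c ∧ e (x c) (u i) ≤ W (η k) := by
    intro i k
    by_cases h : ∃ l, r (A (η k)) l ∧ e (x l) (u i) ≤ W (η k)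
    · exact h.imp fun c hc _ _ _ => hc
    · exact ⟨hne.some, fun l hl hl' => absurd ⟨l, hl, hl'⟩ h⟩
  choose g hg using hg
  have hstep : ∀ (n : ℕ) (l : ι), ∃ m, r l m ∧ r (A (δ (n + 1))) m ∧
      r (g n.unpair.1 n.unpair.2) m := by
    intro n l
    obtain ⟨a, h1, h2⟩ := hr.2 l (A (δ (n + 1)))
    obtain ⟨b, h3, h4⟩ := hr.2 a (g n.unpair.1 n.unpair.2)
    exact ⟨b, hr.1 _ _ _ h1 h3, hr.1 _ _ _ h2 h3, h4⟩
  choose F hF1 hF2 hF3 using hstep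
  obtain ⟨p₀, hp₀, -⟩ := hr.2 (A (δ 0)) (A (δ 0))
  let p : ℕ → ι := fun n => Nat.rec p₀ F n
  have hp : ∀ n, r (p n) (p (n + 1)) := fun n => hF1 n (p n)
  have hpA : ∀ n, r (A (δ n)) (p n) := by
    rintro (_ | n)
    · exact hp₀
    · exact hF2 n (p n)
  have hpg : ∀ n m, n + 1 ≤ m → r (g n.unpair.1 n.unpair.2) (p m) := by
    intro n m hnm
    induction m, hnm using Nat.le_induction with
    | base => exact hF3 n (p n)
    | succ m _ ih => exact hr.1 _ _ _ ih (hp m)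
  refine ⟨p, hp, fun n l hl => hA _ (hδ n) _ _ (hpA n) hl, fun ε hε => ?_⟩
  obtain ⟨k, hk⟩ :=
    (ENNReal.eventually_inv_two_pow_le (ENNReal.div_pos hε.ne' (by simp : (3 : ℝ≥0∞) ≠ ⊤))).exists
  refine ⟨A (η k), fun l hl => ?_⟩
  obtain ⟨i, hi⟩ : ∃ i, e (x l) (u i) < W (η k) := by
    have h : (⨅ y ∈ Set.range u, e (x l) y) < W (η k) := by
      rw [hdense]
      exact hW0 _ (hη k)
    simpa [iInf_lt_iff] using h
  obtain ⟨hc, hc'⟩ := hg i k l hl hi.le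
  filter_upwards [eventually_ge_atTop (Nat.pair i k + 1)] with n hn
  have hgn : r (g i k) (p n) := by simpa using hpg (Nat.pair i k) n hn
  calc d (x l) (x (p n))
      ≤ d (x l) (u i) + (d (u i) (x (g i k)) + d (x (g i k)) (x (p n))) :=
        (hd _ _ _).trans (add_le_add_right (hd _ _ _) _)
    _ ≤ ε / 3 + (ε / 3 + ε / 3) := by
        refine add_le_add ((hW _ (hη k) _ _ hi.le).trans hk) (add_le_add
          ((hW _ (hη k) _ _ ((hsym _ _).trans_le hc')).trans hk)
          ((hA _ (hη k) _ _ hc hgn).le.trans hk))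
    _ = ε := by rw [← add_assoc, ENNReal.add_thirds]

end Distances

/-- If moreover `X` is `e`-separable, the set `Y` can be chosen `≤ᵈ`-directed. -/
theorem cauchy_to_leDDirected {X : Type u} {ι : Type v}
    (d e : X → X → ℝ≥0∞) (hd : IsDistance d) (he : IsDistance e)
    (hsym : ∀ x y : X, e x y = e y x)
    (hcomp : IsYonedaComplete e)
    (hsep : ∃ Y₀ : Set X, Y₀.Countable ∧ ∀ x : X, (⨅ y ∈ Y₀, e x y) = 0)
    (h1 : SubEquiv (ePhiD e d) d) (h2 : SubEquiv d e)
    (r : ι → ι → Prop) (hne : Nonempty ι) (hr : DirectedIndex r)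
    (x : ι → X) (hx : IsCauchyNet d r x) :
    ∃ Y : Set X, LeDDirected d Y ∧
      (∀ z : X, NetLimEq r (fun l => d (x l) z) (⨆ y ∈ Y, d y z)) ∧
      (∀ z : X, NetLimEq r (fun l => d z (x l)) (⨅ y ∈ Y, d z y)) := by
  have hrefl : ∀ a, e a a = 0 := by
    intro a
    obtain ⟨Y₀, -, hdense⟩ := hsep
    refine nonpos_iff_eq_zero.1 (le_of_forall_pos_le_add fun c hc => ?_)
    rw [zero_add]
    have h : (⨅ y ∈ Y₀, e a y) < c / 2 := by
      rw [hdense]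
      exact ENNReal.half_pos hc.ne'
    simp only [iInf_lt_iff] at h
    obtain ⟨y, -, hy⟩ := h
    calc e a a ≤ e a y + e y a := he _ _ _
      _ = e a y + e a y := by rw [hsym y a]
      _ ≤ c / 2 + c / 2 := add_le_add hy.le hy.le
      _ = c := ENNReal.add_halves c
  have hdrefl : ∀ a, d a a = 0 := by
    intro a
    refine nonpos_iff_eq_zero.1 (le_of_forall_pos_le_add fun c hc => ?_)
    rw [zero_add]
    obtain ⟨w, -, hw⟩ := h2 c hc
    exact hw a a (by simp [hrefl])
  obtain ⟨δ, hδ0, hδ⟩ := exists_increasing_asymptotic hd he hsym hrefl hcomp h1 h2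
  obtain ⟨p, hp, hpδ, hcof⟩ := exists_cofinal_seq_of_isCauchyNet hd hsym hsep h2 hne hr hx
    (fun n => min (δ n) (2⁻¹ ^ n)) fun n => lt_min (hδ0 n) (ENNReal.inv_two_pow_pos n)
  obtain ⟨y, hy, hxy⟩ := hδ (fun n => x (p n)) fun n =>
    (hpδ n _ (hp n)).le.trans (min_le_left _ _)
  have hmono : ∀ n m, n ≤ m → d (y n) (y m) = 0 := by
    intro n m hnm
    induction m, hnm using Nat.le_induction with
    | base => exact hdrefl _
    | succ m _ ih =>
      exact nonpos_iff_eq_zero.1 ((hd _ (y m) _).trans (by rw [ih, hy, add_zero]))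
  have hclose : ∀ ε : ℝ≥0∞, 0 < ε →
      ∀ᶠ n in atTop, d (y n) (x (p n)) ≤ ε ∧ d (x (p n)) (y n) ≤ ε := by
    intro ε hε
    obtain ⟨w, hw, hw'⟩ := h2 ε hε
    filter_upwards [ENNReal.eventually_two_mul_inv_two_pow_le hw] with n hn
    exact ⟨hw' _ _ ((hsym _ _).trans_le ((hxy n).trans hn)), hw' _ _ ((hxy n).trans hn)⟩
  refine ⟨Set.range y, ⟨Set.range_nonempty y, ?_⟩, netLimEq_of_mutually_cofinal hd hr ?_ ?_⟩
  · rintro _ ⟨n, rfl⟩ _ ⟨m, rfl⟩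
    exact ⟨y (max n m), ⟨_, rfl⟩, hmono _ _ (le_max_left _ _), hmono _ _ (le_max_right _ _)⟩
  · rintro _ ⟨n, rfl⟩ ε hε
    have hε2 : 0 < ε / 2 := ENNReal.half_pos hε.ne'
    obtain ⟨m, ⟨hm, -⟩, hm', hnm⟩ := ((hclose _ hε2).and
      ((ENNReal.eventually_inv_two_pow_le hε2).and (eventually_ge_atTop n))).exists
    refine ⟨p m, fun l hl => ?_⟩
    calc d (y n) (x l)
        ≤ d (y n) (y m) + (d (y m) (x (p m)) + d (x (p m)) (x l)) :=
          (hd _ _ _).trans (add_le_add_right (hd _ _ _) _)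
      _ ≤ 0 + (ε / 2 + ε / 2) := add_le_add (hmono n m hnm).le
          (add_le_add hm ((hpδ m l hl).le.trans ((min_le_right _ _).trans hm')))
      _ = ε := by rw [zero_add, ENNReal.add_halves]
  · intro ε hε
    have hε2 : 0 < ε / 2 := ENNReal.half_pos hε.ne'
    obtain ⟨α, hα⟩ := hcof _ hε2
    refine ⟨α, fun l hl => ?_⟩
    obtain ⟨n, hn, -, hn'⟩ := ((hα l hl).and (hclose _ hε2)).exists
    refine ⟨y n, ⟨n, rfl⟩, (hd _ (x (p n)) _).trans ?_⟩
    exact (add_le_add hn hn').trans (ENNReal.add_halves ε).le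
end
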